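/- Let M be the 6×6 matrix over ℤ[q] with rows: row 1: (q⁴+q³−q²−q, q³−q, q⁵−2q⁴−q³+2q², q⁵−q³, q⁶−2q⁵−q⁴+2q, −2q⁴−q³+2q²+q); row 2: (q³−q, q⁴+q³−q²−q, q⁵−q³, q⁵−2q⁴−q³+2q², q⁶−2q⁵−q⁴+2q, −2q⁴−q³+2q²+q); row 3: (q³−2q², q³, q⁵+q⁴−3q³+3q², q⁵−3q³, q⁶−2q⁵−3q⁴+4q³, −2q⁴+2q³); row 4: (q³, q³−2q², q⁵−3q³, q⁵+q⁴−3q³+3q², q⁶−2q⁵−3q⁴+4q³, −2q⁴+2q³); row 5: (q³, q³, q⁵−3q³, q⁵−3q³, q⁶−2q⁵−2q⁴+4q³+q², −2q⁴); row 6: (−1, −1, 2q², 2q², −4q²+2, q⁴−2q²+2q+1). For g ≥ 0 set v^g = M^g·(1,0,0,0,0,0)ᵗ and write v^g = (ẽ₀^g, ẽ₁^g, ẽ₂^g, ẽ₃^g, ã^g, b̃^g). Then for every g ≥ 1, the identity 2·ã^g = 2(q³−q)^{2g−1} + (q²+q)^{2g−1} − (q²−q)^{2g−1} holds in ℤ[q];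 in particular ã^g = ẽ₃^g for all g ≥ 1. -/

import Mathlib

open Polynomial Matrix

noncomputable section

/-- The indeterminate `q` of `ℤ[q]`. -/
def q : Polynomial ℤ := Polynomial.X

/-- The transition matrix `M` of the genus-adding handle attachment. -/
def M : Matrix (Fin 6) (Fin 6) (Polynomial ℤ) :=
  !![q^4+q^3-q^2-q, q^3-q, q^5-2*q^4-q^3+2*q^2, q^5-q^3, q^6-2*q^5-q^4+2*q, -2*q^4-q^3+2*q^2+q;
     q^3-q, q^4+q^3-q^2-q, q^5-q^3, q^5-2*q^4-q^3+2*q^2, q^6-2*q^5-q^4+2*q, -2*q^4-q^3+2*q^2+q;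
     q^3-2*q^2, q^3, q^5+q^4-3*q^3+3*q^2, q^5-3*q^3, q^6-2*q^5-3*q^4+4*q^3, -2*q^4+2*q^3;
     q^3, q^3-2*q^2, q^5-3*q^3, q^5+q^4-3*q^3+3*q^2, q^6-2*q^5-3*q^4+4*q^3, -2*q^4+2*q^3;
     q^3, q^3, q^5-3*q^3, q^5-3*q^3, q^6-2*q^5-2*q^4+4*q^3+q^2, -2*q^4;
     -1, -1, 2*q^2, 2*q^2, -4*q^2+2, q^4-2*q^2+2*q+1]

/-- `v g = M^g · (1,0,0,0,0,0)ᵗ`, whose components are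
`(ẽ₀^g, ẽ₁^g, ẽ₂^g, ẽ₃^g, ã^g, b̃^g)`. -/
def v (g : ℕ) : Fin 6 → Polynomial ℤ :=
  (M ^ g).mulVec ![1, 0, 0, 0, 0, 0]

lemma v_succ (g : ℕ) : v (g + 1) = M.mulVec (v g) := by
  simp [v, pow_succ', Matrix.mulVec_mulVec]

/-- Closed form for twice `v (n + 1)`: a combination of odd powers of `q ^ 3 - q`, `q ^ 2 + q`,
`q ^ 2 - q` and `q ^ 2 - 1`. -/
lemma two_smul_v_succ (n : ℕ) :
    (2 : Polynomial ℤ) • v (n + 1) =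
      (q^3-q)^(2*n+1) • ![2, 2, 2, 2, 2, 0]
        + (q^2+q)^(2*n+1) • ![q^2-q, 1-q, -q, 1, 1, -1]
        + (q^2-q)^(2*n+1) • ![q^2-q-2, -(q+1), q-2, -1, -1, -1]
        + (q^2-1)^(2*n+1) • ![2*q, 2*q, 0, 0, 0, 2] := by
  induction n with
  | zero =>
    rw [v_succ]
    ext1 i
    fin_cases i <;>
      simp [v, M] <;> ring
  | succ n ih =>
    rw [v_succ, ← Matrix.mulVec_smul, ih]
    have odd_pow (a : Polynomial ℤ) : a^(2*(n+1)+1) = a^2 * a^(2*n+1) := by ring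
    simp only [odd_pow]
    generalize (q^3-q)^(2*n+1) = A, (q^2+q)^(2*n+1) = B, (q^2-q)^(2*n+1) = C,
      (q^2-1)^(2*n+1) = D
    ext1 i
    fin_cases i <;>
      simp [M, Matrix.mulVec, dotProduct, Fin.sum_univ_succ] <;> ring

theorem stmt_4 (g : ℕ) (hg : 1 ≤ g) :
    2 * v g 4 =
      2*(q^3-q)^(2*g-1) + (q^2+q)^(2*g-1) - (q^2-q)^(2*g-1)
    ∧ v g 4 = v g 3 := by
  obtain ⟨n, rfl⟩ := Nat.exists_eq_add_of_le' hg
  have h₃ := congrFun (two_smul_v_succ n) 3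
  have h₄ := congrFun (two_smul_v_succ n) 4
  simp at h₃ h₄
  have two_mul_sub : 2 * (n + 1) - 1 = 2 * n + 1 := by omega
  rw [two_mul_sub]
  constructor
  · rw [h₄]
    ring
  · exact mul_left_cancel₀ two_ne_zero (h₄.trans h₃.symm)
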